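/- arXiv:physics/0602036 — 3 statements merged into one kernel-verified Lean document; each statement's English description precedes it below -/
import Mathlib

section
/- (Cramér–Rao inequality.) Let P : ℝ → ℝ be everywhere differentiable with P(x) > 0 for all x, Lebesgue integrable with ∫ P(x) dx = 1, and let μ = ∫ x·P(x) dx (assumed to exist, i.e. x ↦ x·P(x) integrable). Assume the functions x ↦ (x−μ)²·P(x), x ↦ (P'(x))²/P(x), and x ↦ (x−μ)·P'(x) are integrable and that ∫ (x−μ)·P'(x) dx = −1 (which holds by integration by parts when (x−μ)·P(x) → 0 at ±∞). Then ( ∫ (x−μ)²·P(x) dx )·( ∫ (P'(x))²/P(x) dx ) ≥ 1; that is, Var(x) ≥ F_x⁻¹, or Δx ≥ δx where δx = F_x^{-1/2} is the Fisher length. -/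
open MeasureTheory

/-- Weighted Cauchy–Schwarz: `(∫ f g)² ≤ (∫ f² w) (∫ g² / w)` for a positive weight `w`. -/
theorem sq_integral_mul_le_integral_sq_mul_mul_integral_sq_div {α : Type*} [MeasurableSpace α]
    {ν : Measure α} {f g w : α → ℝ} (hw : ∀ x, 0 < w x)
    (hf : Integrable (fun x => f x ^ 2 * w x) ν) (hg : Integrable (fun x => g x ^ 2 / w x) ν)
    (hfg : Integrable (fun x => f x * g x) ν) :
    (∫ x, f x * g x ∂ν) ^ 2 ≤ (∫ x, f x ^ 2 * w x ∂ν) * ∫ x, g x ^ 2 / w x ∂ν := by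
  have quadratic_nonneg (t : ℝ) : 0 ≤ (∫ x, f x ^ 2 * w x ∂ν) * (t * t) +
      (2 * ∫ x, f x * g x ∂ν) * t + ∫ x, g x ^ 2 / w x ∂ν := by
    calc 0 ≤ ∫ x, (t * t) * (f x ^ 2 * w x) + (2 * t) * (f x * g x) + g x ^ 2 / w x ∂ν := by
          refine integral_nonneg fun x => ?_
          have hx := hw x
          have expand : (t * t) * (f x ^ 2 * w x) + (2 * t) * (f x * g x) + g x ^ 2 / w x =
              (t * f x * w x + g x) ^ 2 / w x := by
            field_simp
            ring
          simp only [Pi.zero_apply, expand]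
          positivity
      _ = _ := by
          rw [integral_add (by fun_prop) hg,
            integral_add (hf.const_mul _) (hfg.const_mul _), integral_const_mul,
            integral_const_mul]
          ring
  have := discrim_le_zero quadratic_nonneg
  rw [discrim] at this
  linarith

/-- Cramér–Rao inequality: `Var(x) · F_x ≥ 1`, i.e. the variance of a probability
density `P` is at least the reciprocal of its Fisher information. -/
theorem stmt4 (P : ℝ → ℝ) (hP : Differentiable ℝ P) (hpos : ∀ x, 0 < P x)
    (hInt : Integrable P) (hnorm : ∫ x, P x = 1)
    (μ : ℝ) (hxP : Integrable (fun x => x * P x)) (hμ : μ = ∫ x, x * P x)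
    (h1 : Integrable (fun x => (x - μ) ^ 2 * P x))
    (h2 : Integrable (fun x => (deriv P x) ^ 2 / P x))
    (h3 : Integrable (fun x => (x - μ) * deriv P x))
    (h4 : ∫ x, (x - μ) * deriv P x = -1) :
    1 ≤ (∫ x, (x - μ) ^ 2 * P x) * ∫ x, (deriv P x) ^ 2 / P x := by
  simpa [h4] using sq_integral_mul_le_integral_sq_mul_mul_integral_sq_div hpos h1 h2 h3
end

section
/- (de Bruijn-type identity: the Fisher information is the time derivative of the differential entropy.) Let D > 0 and ρ : ℝ × ℝ → ℝ with ρ(t,x) > 0 for all (t,x). Fix t₀ and assume: (i) for every x, t ↦ ρ(t,x) is differentiable at t₀ and x ↦ ρ(t₀,x) is everywhere differentiable with everywhere differentiable spatial derivative, and the diffusion equation ∂ₜρ(t₀,x) = D·∂ₓ²ρ(t₀,x) holds for all x; (ii) x ↦ ∂ₓ²ρ(t₀,x)·(log ρ(t₀,x) + 1) and x ↦ (∂ₓρ(t₀,x))²/ρ(t₀,x) are Lebesgue integrable and ∂ₓρ(t₀,x)·(log ρ(t₀,x)+1) → 0 as x → ±∞; (iii) the map t ↦ −∫ ρ(t,x)·log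 ρ(t,x) dx is differentiable at t₀ with derivative −∫ ∂ₜρ(t₀,x)·(log ρ(t₀,x) + 1) dx (differentiation under the integral sign). Then t ↦ −∫ ρ(t,x)·log ρ(t,x) dx has derivative at t₀ equal to D·∫ (∂ₓρ(t₀,x))²/ρ(t₀,x) dx. -/
open MeasureTheory Filter

/-- Integration by parts for a positive density `f`: `∫ f'' (log f + 1) = -∫ f'² / f`. -/
theorem integral_deriv_deriv_mul_log_add_one {f : ℝ → ℝ} (hpos : ∀ x, 0 < f x)
    (hf : Differentiable ℝ f) (hf' : Differentiable ℝ (deriv f))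
    (h1 : Integrable fun x => deriv (deriv f) x * (Real.log (f x) + 1))
    (h2 : Integrable fun x => deriv f x ^ 2 / f x)
    (htop : Tendsto (fun x => deriv f x * (Real.log (f x) + 1)) atTop (nhds 0))
    (hbot : Tendsto (fun x => deriv f x * (Real.log (f x) + 1)) atBot (nhds 0)) :
    ∫ x, deriv (deriv f) x * (Real.log (f x) + 1) = -∫ x, deriv f x ^ 2 / f x := by
  have hderiv : ∀ x, HasDerivAt (fun x => deriv f x * (Real.log (f x) + 1))
      (deriv (deriv f) x * (Real.log (f x) + 1) + deriv f x ^ 2 / f x) x := fun x => by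
    have hlog := ((hf x).hasDerivAt.log (hpos x).ne').add_const 1
    refine ((hf' x).hasDerivAt.fun_mul hlog).congr_deriv ?_
    ring
  have h := integral_of_hasDerivAt_of_tendsto hderiv (h1.add h2) hbot htop
  rw [integral_add h1 h2] at h
  linarith

/-- de Bruijn-type identity: for a positive density `ρ` evolving by the diffusion
equation `∂ₜρ = D·∂ₓ²ρ`, the differential entropy `−∫ ρ log ρ` has time derivative
equal to `D` times the Fisher information `∫ (∂ₓρ)²/ρ`. -/
theorem stmt10 (D : ℝ) (hD : 0 < D) (ρ : ℝ → ℝ → ℝ)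
    (hpos : ∀ t x, 0 < ρ t x) (t₀ : ℝ)
    (ht : ∀ x, DifferentiableAt ℝ (fun t => ρ t x) t₀)
    (hx : Differentiable ℝ (fun x => ρ t₀ x))
    (hxx : Differentiable ℝ (deriv (fun x => ρ t₀ x)))
    (hdiffusion : ∀ x, deriv (fun t => ρ t x) t₀ =
      D * deriv (deriv (fun y => ρ t₀ y)) x)
    (h1 : Integrable (fun x =>
      deriv (deriv (fun y => ρ t₀ y)) x * (Real.log (ρ t₀ x) + 1)))
    (h2 : Integrable (fun x => (deriv (fun y => ρ t₀ y) x) ^ 2 / ρ t₀ x))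
    (htop : Tendsto (fun x => deriv (fun y => ρ t₀ y) x * (Real.log (ρ t₀ x) + 1))
      atTop (nhds 0))
    (hbot : Tendsto (fun x => deriv (fun y => ρ t₀ y) x * (Real.log (ρ t₀ x) + 1))
      atBot (nhds 0))
    (hder : HasDerivAt (fun t => -∫ x, ρ t x * Real.log (ρ t x))
      (-∫ x, deriv (fun s => ρ s x) t₀ * (Real.log (ρ t₀ x) + 1)) t₀) :
    HasDerivAt (fun t => -∫ x, ρ t x * Real.log (ρ t x))
      (D * ∫ x, (deriv (fun y => ρ t₀ y) x) ^ 2 / ρ t₀ x) t₀ := by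
  convert hder using 1
  simp_rw [hdiffusion, mul_assoc]
  rw [integral_const_mul, integral_deriv_deriv_mul_log_add_one (hpos t₀) hx hxx h1 h2 htop hbot]
  ring
end

section
/- (The quantum mean momentum equals the mean classical momentum.) Let ℏ > 0 and let R, S : ℝ → ℝ be everywhere differentiable, and set ψ(x) = R(x)·exp(i·S(x)/ℏ). Assume R², R·R', and R²·S' are Lebesgue integrable on ℝ. Then ∫ conj(ψ(x)) · ( −i·ℏ·ψ'(x) ) dx = ∫ R(x)²·S'(x) dx (the right-hand side viewed as a real, hence complex, number). That is, ⟨p⟩_ψ = ⟨p_cl⟩_ψ, where p is the momentum operator −iℏ·d/dx and p_cl = S' is the classical momentum. -/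
open MeasureTheory

/-- The integral of `R·R'` vanishes when `R²` and `R·R'` are integrable. -/
lemma integral_mul_deriv_self_eq_zero {R : ℝ → ℝ} (hR : Differentiable ℝ R)
    (h1 : Integrable (fun x => (R x) ^ 2)) (h2 : Integrable (fun x => R x * deriv R x)) :
    ∫ x, R x * deriv R x = 0 := by
  have hderiv (x : ℝ) : HasDerivAt (fun x => (R x) ^ 2 / 2) (R x * deriv R x) x := by
    refine (((hR x).hasDerivAt.fun_pow 2).div_const 2).congr_deriv ?_
    push_cast
    ring
  exact integral_eq_zero_of_hasDerivAt_of_integrable hderiv h2 (h1.div_const 2)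

/-- The pointwise identity `ψ*·(−iℏψ') = R²·S' − iℏ·R·R'` for `ψ = R·exp(i·S/ℏ)`. -/
lemma conj_mul_momentum_polar {ℏ : ℝ} (hℏ : ℏ ≠ 0) {R S : ℝ → ℝ} {ψ : ℝ → ℂ}
    (hψ : ∀ x, ψ x = (R x : ℂ) * Complex.exp (Complex.I * (S x : ℂ) / (ℏ : ℂ))) {x : ℝ}
    (hR : DifferentiableAt ℝ R x) (hS : DifferentiableAt ℝ S x) :
    (starRingEnd ℂ) (ψ x) * (-Complex.I * (ℏ : ℂ) * deriv ψ x) =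
      (((R x) ^ 2 * deriv S x : ℝ) : ℂ) - Complex.I * ℏ * ((R x * deriv R x : ℝ) : ℂ) := by
  have hderiv : deriv ψ x =
      (((deriv R x : ℝ) : ℂ) + R x * (Complex.I * (deriv S x : ℝ) / ℏ)) *
        Complex.exp (Complex.I * (S x : ℂ) / (ℏ : ℂ)) := by
    rw [funext hψ, (hR.hasDerivAt.ofReal_comp.fun_mul
      ((hS.hasDerivAt.ofReal_comp.const_mul Complex.I).div_const (ℏ : ℂ)).cexp).deriv]
    ring
  have hexp : Complex.exp (-Complex.I * (S x : ℂ) / (ℏ : ℂ)) *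
      Complex.exp (Complex.I * (S x : ℂ) / (ℏ : ℂ)) = 1 := by
    rw [← Complex.exp_add, neg_mul, neg_div, neg_add_cancel, Complex.exp_zero]
  have hℏ' : (ℏ : ℂ) ≠ 0 := Complex.ofReal_ne_zero.mpr hℏ
  rw [hderiv, hψ, map_mul, ← Complex.exp_conj, map_div₀, map_mul, Complex.conj_I,
    Complex.conj_ofReal, Complex.conj_ofReal, Complex.conj_ofReal]
  calc _ = (R x : ℂ) * (-Complex.I * ℏ * ((deriv R x : ℝ) + R x * (Complex.I * (deriv S x : ℝ) / ℏ))) *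
        (Complex.exp (-Complex.I * (S x : ℂ) / (ℏ : ℂ)) *
          Complex.exp (Complex.I * (S x : ℂ) / (ℏ : ℂ))) := by ring
    _ = _ := by
      rw [hexp]
      push_cast
      field_simp
      linear_combination (-(R x : ℂ) ^ 2 * (deriv S x : ℝ)) * Complex.I_sq

/-- The quantum mean momentum equals the mean classical momentum:
`∫ ψ*·(−iℏψ') = ∫ R²·S'` for `ψ = R·exp(i·S/ℏ)` in polar form. -/
theorem stmt18 (ℏ : ℝ) (hℏ : 0 < ℏ) (R S : ℝ → ℝ)
    (hR : Differentiable ℝ R) (hS : Differentiable ℝ S)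
    (ψ : ℝ → ℂ)
    (hψ : ∀ x, ψ x = (R x : ℂ) * Complex.exp (Complex.I * (S x : ℂ) / (ℏ : ℂ)))
    (h1 : Integrable (fun x => (R x) ^ 2))
    (h2 : Integrable (fun x => R x * deriv R x))
    (h3 : Integrable (fun x => (R x) ^ 2 * deriv S x)) :
    ∫ x, (starRingEnd ℂ) (ψ x) * (-Complex.I * (ℏ : ℂ) * deriv ψ x) =
      ((∫ x, (R x) ^ 2 * deriv S x : ℝ) : ℂ) := by
  simp_rw [fun x => conj_mul_momentum_polar hℏ.ne' hψ (hR x) (hS x)]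
  rw [integral_sub h3.ofReal (h2.ofReal.const_mul _), integral_const_mul, integral_complex_ofReal,
    integral_complex_ofReal, integral_mul_deriv_self_eq_zero hR h1 h2, Complex.ofReal_zero, mul_zero,
    sub_zero]
end
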